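/- Let M be a Garside monoid and b, g, g' ∈ M. If b^g and b^{g'} are defined (i.e. g ≼ b g and g' ≼ b g'), then b^{leftgcd(g,g')} and b^{rightlcm(g,g')} are defined: leftgcd(g,g') ≼ b·leftgcd(g,g') and rightlcm(g,g') ≼ b·rightlcm(g,g'). -/

import Mathlib

/-!
Common setting: Garside monoids, standard parabolic submonoids, heads,
ribbons, following Digne–Michel, "Ribbons in Garside monoids".
-/

namespace GarsidePaper

variable {M : Type*}

/-- `a` left-divides `b` : `b = a * c` for some `c`. -/
def LDvd [Monoid M] (a b : M) : Prop := ∃ c, b = a * c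

/-- `a` right-divides `b` : `b = c * a` for some `c`. -/
def RDvd [Monoid M] (a b : M) : Prop := ∃ c, b = c * a

/-- `a` is a factor of `b` : `a` left-divides a right-divisor of `b`. -/
def IsFactor [Monoid M] (a b : M) : Prop := ∃ c, LDvd a c ∧ RDvd c b

/-- A Garside structure on a (left- and right-) cancellative monoid `M`:
left/right gcds and lcms, Noetherianity, and a Garside element `Δ`. -/
structure GarsideStruct (M : Type*) [CancelMonoid M] where
  /-- left-gcd : gcd for the left-divisibility order -/
  lgcd : M → M → M
  lgcd_dvd_left : ∀ a b, LDvd (lgcd a b) a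
  lgcd_dvd_right : ∀ a b, LDvd (lgcd a b) b
  lgcd_greatest : ∀ a b d, LDvd d a → LDvd d b → LDvd d (lgcd a b)
  /-- right-lcm : lcm for the left-divisibility order -/
  rlcm : M → M → M
  ldvd_rlcm_left : ∀ a b, LDvd a (rlcm a b)
  ldvd_rlcm_right : ∀ a b, LDvd b (rlcm a b)
  rlcm_least : ∀ a b m, LDvd a m → LDvd b m → LDvd (rlcm a b) m
  /-- right-gcd : gcd for the right-divisibility order -/
  rgcd : M → M → M
  rgcd_dvd_left : ∀ a b, RDvd (rgcd a b) a
  rgcd_dvd_right : ∀ a b, RDvd (rgcd a b) b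
  rgcd_greatest : ∀ a b d, RDvd d a → RDvd d b → RDvd d (rgcd a b)
  /-- left-lcm : lcm for the right-divisibility order -/
  llcm : M → M → M
  rdvd_llcm_left : ∀ a b, RDvd a (llcm a b)
  rdvd_llcm_right : ∀ a b, RDvd b (llcm a b)
  llcm_least : ∀ a b m, RDvd a m → RDvd b m → RDvd (llcm a b) m
  /-- Noetherian: no infinite sequence where each term is a proper factor
  of the previous one. -/
  noetherian : WellFounded (fun a b : M => IsFactor a b ∧ a ≠ b)
  /-- the Garside element -/
  Δ : M
  /-- the left- and right-divisors of `Δ` coincide -/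
  delta_balanced : ∀ a : M, LDvd a Δ ↔ RDvd a Δ
  /-- the divisors of `Δ` generate `M` -/
  delta_generates : Submonoid.closure {a : M | LDvd a Δ} = ⊤

variable [CancelMonoid M]

/-- An atom: an element with no proper nontrivial divisor (factor). -/
def IsAtom' (a : M) : Prop := a ≠ 1 ∧ ∀ b : M, IsFactor b a → b = 1 ∨ b = a

/-- A standard parabolic submonoid: a submonoid closed under factors in which
every element of `M` has a maximal left-divisor (the left `P`-head) and a
maximal right-divisor (the right `P`-head) lying in `P`. -/
structure IsStdParabolic (P : Submonoid M) : Prop where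
  factor_closed : ∀ a b : M, b ∈ P → IsFactor a b → a ∈ P
  exists_left_head : ∀ g : M, ∃ h, h ∈ P ∧ LDvd h g ∧
    ∀ h', h' ∈ P → LDvd h' g → LDvd h' h
  exists_right_head : ∀ g : M, ∃ h, h ∈ P ∧ RDvd h g ∧
    ∀ h', h' ∈ P → RDvd h' g → RDvd h' h

/-- `h` is the left `P`-head `H_P g` of `g` : the maximal left-divisor of `g`
lying in `P`. -/
def IsLeftHead (P : Set M) (g h : M) : Prop :=
  h ∈ P ∧ LDvd h g ∧ ∀ h', h' ∈ P → LDvd h' g → LDvd h' h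

/-- `h` is the right `P`-head of `g` : the maximal right-divisor of `g`
lying in `P`. -/
def IsRightHead (P : Set M) (g h : M) : Prop :=
  h ∈ P ∧ RDvd h g ∧ ∀ h', h' ∈ P → RDvd h' g → RDvd h' h

/-- `g` is `P`-reduced : `H_P g = 1`, i.e. the only left-divisor of `g`
lying in `P` is `1`. -/
def PReduced (P : Set M) (g : M) : Prop := ∀ h ∈ P, LDvd h g → h = 1

/-- `P ^ g` is defined: `p ^ g` is defined (`g ≼ p * g`) for every `p ∈ P`. -/
def ConjSetDef (P : Set M) (g : M) : Prop := ∀ p ∈ P, LDvd g (p * g)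

/-- The set `P ^ g = { p ^ g : p ∈ P }`, where `p ^ g` is the unique `c`
with `p * g = g * c`. -/
def conjSet (P : Set M) (g : M) : Set M := {c : M | ∃ p ∈ P, p * g = g * c}

/-- A `P`-ribbon: a `P`-reduced element `g` such that `P ^ g` is defined. -/
def IsRibbon (P : Set M) (g : M) : Prop := PReduced P g ∧ ConjSetDef P g

/-- `P` is the smallest standard parabolic submonoid containing `S₁`. -/
def IsSmallestParabolicContaining (S₁ : Set M) (P : Submonoid M) : Prop :=
  IsStdParabolic P ∧ S₁ ⊆ (P : Set M) ∧
    ∀ Q : Submonoid M, IsStdParabolic Q → S₁ ⊆ (Q : Set M) → P ≤ Q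

/-- Assumption 1: for any set `S₁` of atoms, the right-lcm of `S₁` is the
Garside element `Δ_{P₁} = H_{P₁}(Δ)` of the smallest standard parabolic
submonoid `P₁` containing `S₁`. -/
def Assumption1 (G : GarsideStruct M) : Prop :=
  ∀ S₁ : Set M, (∀ s ∈ S₁, IsAtom' s) →
    ∀ P₁ : Submonoid M, IsSmallestParabolicContaining S₁ P₁ →
      ∀ d : M, IsLeftHead (P₁ : Set M) G.Δ d →
        (∀ s ∈ S₁, LDvd s d) ∧ ∀ m : M, (∀ s ∈ S₁, LDvd s m) → LDvd d m

/-- Assumption 2: some (positive) power of `Δ` is central. -/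
def Assumption2 (G : GarsideStruct M) : Prop :=
  ∃ n : ℕ, 0 < n ∧ ∀ x : M, G.Δ ^ n * x = x * G.Δ ^ n

/-- `v = v_{s,P}` : the element defined by `Δ_{P_s} = Δ_P * v`, where `P_s`
is the smallest standard parabolic submonoid containing `P` and `s`. -/
def IsVsp (G : GarsideStruct M) (P : Submonoid M) (s v : M) : Prop :=
  ∃ Ps : Submonoid M, IsSmallestParabolicContaining ((P : Set M) ∪ {s}) Ps ∧
    ∃ dP dPs : M, IsLeftHead (P : Set M) G.Δ dP ∧
      IsLeftHead (Ps : Set M) G.Δ dPs ∧ dPs = dP * v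

theorem LDvd.trans {N : Type*} [Monoid N] {a b c : N} (hab : LDvd a b) (hbc : LDvd b c) :
    LDvd a c := by
  obtain ⟨x, rfl⟩ := hab
  obtain ⟨y, rfl⟩ := hbc
  exact ⟨x * y, mul_assoc a x y⟩

theorem LDvd.mul_left {N : Type*} [Monoid N] {a c : N} (h : LDvd a c) (b : N) :
    LDvd (b * a) (b * c) := by
  obtain ⟨x, rfl⟩ := h
  exact ⟨x, (mul_assoc b a x).symm⟩

theorem LDvd.of_mul_left {a b c : M} (h : LDvd (b * a) (b * c)) : LDvd a c := by
  obtain ⟨x, hx⟩ := h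
  exact ⟨x, mul_left_cancel (hx.trans (mul_assoc b a x))⟩

/-- A common left-divisor of `b * g` and `b * g'` left-divides `b * leftgcd(g,g')`. -/
theorem GarsideStruct.ldvd_mul_lgcd (G : GarsideStruct M) {b g g' d : M}
    (h : LDvd d (b * g)) (h' : LDvd d (b * g')) : LDvd d (b * G.lgcd g g') := by
  have hd := G.lgcd_greatest _ _ _ h h'
  obtain ⟨f, hf⟩ := G.lgcd_greatest (b * g) (b * g') b ⟨g, rfl⟩ ⟨g', rfl⟩
  have hg := G.lgcd_dvd_left (b * g) (b * g')
  have hg' := G.lgcd_dvd_right (b * g) (b * g')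
  rw [hf] at hd hg hg'
  exact hd.trans ((G.lgcd_greatest _ _ _ hg.of_mul_left hg'.of_mul_left).mul_left b)

/-- if `b ^ g` and `b ^ g'` are defined, then so are
`b ^ leftgcd(g,g')` and `b ^ rightlcm(g,g')`. -/
theorem statement9 (G : GarsideStruct M) (b g g' : M)
    (h1 : LDvd g (b * g)) (h2 : LDvd g' (b * g')) :
    LDvd (G.lgcd g g') (b * G.lgcd g g') ∧
      LDvd (G.rlcm g g') (b * G.rlcm g g') := by
  constructor
  · exact G.ldvd_mul_lgcd ((G.lgcd_dvd_left g g').trans h1) ((G.lgcd_dvd_right g g').trans h2)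
  · exact G.rlcm_least _ _ _ (h1.trans ((G.ldvd_rlcm_left g g').mul_left b))
      (h2.trans ((G.ldvd_rlcm_right g g').mul_left b))

end GarsidePaper
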